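/- arXiv:2403.08128 — 2 statements merged into one kernel-verified Lean document; each statement's English description precedes it below -/
import Mathlib

section
/- Let A → S be a ring homomorphism, I ⊆ S an ideal, and p : S → S/I the quotient map. For every S/I-module M the sequence 0 → Der_A(S/I, M) → Der_A(S, M) → Hom_{S/I}(I/I², M) is exact, where the first map sends a derivation d to d ∘ p, and the second map sends a derivation d : S → M to the S/I-linear map I/I² → M induced by restricting d to I (this is well defined since d(I²) ⊆ IM = 0). -/
/-- For a ring map `A → S`, an ideal `I ⊆ S` and an `S/I`-module `M`,
the sequence `0 → Der_A(S/I, M) → Der_A(S, M) → Hom_{S/I}(I/I², M)` is exact, where the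
first map is composition with the quotient map `p : S → S/I` and the second map `Φ` sends a
derivation `d : S → M` to the `S/I`-linear map `I/I² → M` induced by restricting `d` to `I`
(characterized by `Φ d [f] = d f` for `f ∈ I`). -/
theorem statement0 {A S : Type*} [CommRing A] [CommRing S] [Algebra A S]
    (I : Ideal S)
    (M : Type*) [AddCommGroup M] [Module S M] [Module (S ⧸ I) M] [Module A M]
    [IsScalarTower A S M] [IsScalarTower S (S ⧸ I) M] [IsScalarTower A (S ⧸ I) M]
    (Φ : Derivation A S M → (I.Cotangent →ₗ[S ⧸ I] M))
    (hΦ : ∀ (d : Derivation A S M) (f : I), Φ d (I.toCotangent f) = d f) :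
    Function.Injective (fun d : Derivation A (S ⧸ I) M => d.compAlgebraMap S) ∧
    Function.Exact (fun d : Derivation A (S ⧸ I) M => d.compAlgebraMap S) Φ := by
  have hp (d : Derivation A (S ⧸ I) M) (s : S) :
      d.compAlgebraMap S s = d (Ideal.Quotient.mk I s) := rfl
  refine ⟨fun d e h => ?_, fun d => ⟨fun h => ?_, ?_⟩⟩
  · ext x
    obtain ⟨s, rfl⟩ := Ideal.Quotient.mk_surjective x
    exact DFunLike.congr_fun h s
  · have hd (s : S) (hs : s ∈ I) : d s = 0 := by
      rw [← hΦ d ⟨s, hs⟩, h, LinearMap.zero_apply]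
    have hsmul (s : S) (m : M) : Ideal.Quotient.mk I s • m = s • m :=
      algebraMap_smul (S ⧸ I) s m
    let g : (S ⧸ I) →+ M := QuotientAddGroup.lift I.toAddSubgroup (d : S →+ M) hd
    let l : (S ⧸ I) →ₗ[A] M :=
      { g with
        map_smul' := fun a x => by
          obtain ⟨s, rfl⟩ := Ideal.Quotient.mk_surjective x
          exact d.map_smul a s }
    refine ⟨Derivation.mk' l fun x y => ?_, ?_⟩
    · obtain ⟨s, rfl⟩ := Ideal.Quotient.mk_surjective x
      obtain ⟨t, rfl⟩ := Ideal.Quotient.mk_surjective y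
      rw [hsmul, hsmul]
      exact d.leibniz s t
    · ext s
      rfl
  · rintro ⟨e, rfl⟩
    ext x
    obtain ⟨f, rfl⟩ := I.toCotangent_surjective x
    rw [hΦ, LinearMap.zero_apply, hp, Ideal.Quotient.eq_zero_iff_mem.mpr f.2, map_zero]
end

section
/- Let (A, 𝔪, k) be a regular local ring and J ⊆ 𝔪 an ideal of height h. Then A/J is a regular local ring if and only if the rank of the induced k-linear map J/𝔪J → 𝔪/𝔪² equals h. -/
open IsLocalRing

/-- The height of an ideal: the infimum of the heights of the primes containing it. -/
noncomputable def idealHeight {A : Type*} [CommRing A] (J : Ideal A) : ℕ∞ :=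
  ⨅ P ∈ {P : PrimeSpectrum A | J ≤ P.asIdeal}, Order.height P

/-- A commutative ring is a regular local ring if it is Noetherian, local, and the minimal
number of generators of its maximal ideal equals its Krull dimension. -/
def IsRegularLocal (A : Type*) [CommRing A] : Prop :=
  IsNoetherianRing A ∧ ∃ h : IsLocalRing A,
    ringKrullDim A =
      ((sInf {n : ℕ | ∃ s : Finset A, s.card = n ∧
        Ideal.span (s : Set A) = @IsLocalRing.maximalIdeal A _ h} : ℕ) : WithBot ℕ∞)

lemma LinearIndepOn.finite_and_finrank_span_image {K V ι : Type*} [Field K] [AddCommGroup V]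
    [Module K V] [FiniteDimensional K V] {v : ι → V} {s : Set ι} (hs : LinearIndepOn K v s) :
    s.Finite ∧ Module.finrank K (Submodule.span K (v '' s)) = s.ncard := by
  have : Finite s := LinearIndependent.finite (R := K) hs
  have := Fintype.ofFinite s
  refine ⟨s.toFinite, ?_⟩
  rw [Set.image_eq_range, finrank_span_eq_card (b := fun x : s ↦ v x) hs, Set.ncard_eq_toFinset_card',
    Set.toFinset_card]

lemma exists_natCast_eq_ringKrullDim (R : Type*) [CommRing R] [FiniteRingKrullDim R] :
    ∃ n : ℕ, ringKrullDim R = n := by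
  obtain ⟨m, hm⟩ := WithBot.ne_bot_iff_exists.mp (ringKrullDim_ne_bot (R := R))
  have hm' : m ≠ ⊤ := fun h ↦ ringKrullDim_ne_top (R := R) (by rw [← hm, h]; rfl)
  obtain ⟨n, rfl⟩ := ENat.ne_top_iff_exists.mp hm'
  exact ⟨n, hm.symm⟩

lemma Ideal.eq_of_le_of_ringKrullDim_quotient_le {R : Type*} [CommRing R] {P J : Ideal R}
    [P.IsPrime] [FiniteRingKrullDim (R ⧸ P)] (hPJ : P ≤ J)
    (h : ringKrullDim (R ⧸ P) ≤ ringKrullDim (R ⧸ J)) : P = J := by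
  refine le_antisymm hPJ fun y hy ↦ by_contra fun hyP ↦ ?_
  have hy0 : Ideal.Quotient.mk P y ∈ nonZeroDivisors (R ⧸ P) :=
    mem_nonZeroDivisors_of_ne_zero (Ideal.Quotient.eq_zero_iff_mem.not.mpr hyP)
  have hlt := ringKrullDim_succ_le_of_surjective (Ideal.Quotient.factor hPJ)
    (Ideal.Quotient.factor_surjective hPJ) hy0 (by simpa [Ideal.Quotient.eq_zero_iff_mem] using hy)
  have hle := (add_le_add_left h 1).trans hlt
  obtain ⟨n, hn⟩ := exists_natCast_eq_ringKrullDim (R ⧸ P)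
  rw [hn] at hle
  norm_cast at hle
  omega

namespace IsLocalRing

variable {R : Type*} [CommRing R] [IsLocalRing R]

lemma span_coe_eq_maximalIdeal_iff {s : Set (maximalIdeal R)} :
    Ideal.span ((↑) '' s : Set R) = maximalIdeal R ↔ Submodule.span R s = ⊤ := by
  rw [← (Submodule.map_injective_of_injective (maximalIdeal R).subtype_injective).eq_iff,
    Submodule.map_span, Submodule.map_top, Submodule.range_subtype]
  rfl

variable [IsNoetherianRing R]

/-- Elements of `𝔪` that are linearly independent modulo `𝔪²` extend to minimal generators of `𝔪`. -/
lemma exists_superset_linearIndepOn_toCotangent {t : Set (maximalIdeal R)}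
    (ht : LinearIndepOn (ResidueField R) (maximalIdeal R).toCotangent t) :
    ∃ b, t ⊆ b ∧ b.Finite ∧ b.ncard = (maximalIdeal R).spanFinrank ∧
      Ideal.span ((↑) '' b : Set R) = maximalIdeal R := by
  obtain ⟨b, -, htb, hspan, hb⟩ := exists_linearIndepOn_extension ht (Set.subset_univ t)
  have htop : Submodule.span (ResidueField R) ((maximalIdeal R).toCotangent '' b) = ⊤ := by
    rw [Set.image_univ, (maximalIdeal R).toCotangent_surjective.range_eq] at hspan
    exact top_le_iff.mp fun x _ ↦ hspan (Set.mem_univ x)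
  obtain ⟨hfin, hrank⟩ := hb.finite_and_finrank_span_image
  refine ⟨b, htb, hfin, ?_, ?_⟩
  · rw [spanFinrank_maximalIdeal_eq_finrank_cotangentSpace, ← hrank, htop, finrank_top]
  · rw [span_coe_eq_maximalIdeal_iff, ← CotangentSpace.span_image_eq_top_iff, htop]

end IsLocalRing

namespace IsRegularLocalRing

variable {R : Type*} [CommRing R] [IsRegularLocalRing R]

lemma spanFinrank_add_ncard_le_of_linearIndepOn {t : Set (maximalIdeal R)}
    (ht : LinearIndepOn (ResidueField R) (maximalIdeal R).toCotangent t)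
    [IsLocalRing (R ⧸ Ideal.span ((↑) '' t : Set R))] :
    (maximalIdeal (R ⧸ Ideal.span ((↑) '' t : Set R))).spanFinrank + t.ncard ≤
      (maximalIdeal R).spanFinrank := by
  obtain ⟨b, htb, hfin, hcard, hb⟩ := exists_superset_linearIndepOn_toCotangent ht
  set f := Ideal.Quotient.mk (Ideal.span ((↑) '' t : Set R))
  have hmax : maximalIdeal (R ⧸ Ideal.span ((↑) '' t : Set R)) =
      Ideal.span ((fun x : maximalIdeal R ↦ f x) '' (b \ t)) := by
    rw [← map_maximalIdeal_of_surjective f Ideal.Quotient.mk_surjective,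
      ← congrArg (Ideal.map f) hb, Ideal.map_span, Set.image_image]
    refine le_antisymm (Ideal.span_le.mpr ?_) (Ideal.span_mono (Set.image_mono Set.sdiff_subset))
    rintro _ ⟨x, hx, rfl⟩
    by_cases hxt : x ∈ t
    · have : f x = 0 := Ideal.Quotient.eq_zero_iff_mem.mpr
        (Ideal.subset_span (Set.mem_image_of_mem _ hxt))
      simp [this]
    · exact Ideal.subset_span ⟨x, ⟨hx, hxt⟩, rfl⟩
  have hle : (maximalIdeal (R ⧸ Ideal.span ((↑) '' t : Set R))).spanFinrank ≤ (b \ t).ncard := by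
    rw [hmax]
    exact (Submodule.spanFinrank_span_le_ncard_of_finite (hfin.sdiff.image _)).trans
      (Set.ncard_image_le hfin.sdiff)
  rw [← hcard, ← Set.ncard_sdiff_add_ncard_of_subset htb hfin]
  exact Nat.add_le_add_right hle _

lemma span_coe_le_maximalIdeal (t : Set (maximalIdeal R)) :
    Ideal.span ((↑) '' t : Set R) ≤ maximalIdeal R := by
  rw [Ideal.span_le]
  rintro _ ⟨x, -, rfl⟩
  exact x.2

/-- The quotient of a regular local ring by part of a regular system of parameters. -/
lemma quotient_of_linearIndepOn {t : Set (maximalIdeal R)}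
    (ht : LinearIndepOn (ResidueField R) (maximalIdeal R).toCotangent t) :
    IsRegularLocalRing (R ⧸ Ideal.span ((↑) '' t : Set R)) ∧
      ringKrullDim (R ⧸ Ideal.span ((↑) '' t : Set R)) + t.ncard = ringKrullDim R := by
  have hI := span_coe_le_maximalIdeal t
  have : Nontrivial (R ⧸ Ideal.span ((↑) '' t : Set R)) :=
    Ideal.Quotient.nontrivial_iff.mpr (ne_top_of_le_ne_top Ideal.IsPrime.ne_top' hI)
  have : IsLocalRing (R ⧸ Ideal.span ((↑) '' t : Set R)) :=
    .of_surjective' (Ideal.Quotient.mk _) Ideal.Quotient.mk_surjective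
  have hfin := ht.finite_and_finrank_span_image.1
  have h₁ := spanFinrank_add_ncard_le_of_linearIndepOn ht
  have h₂ := ringKrullDim_le_spanFinrank_maximalIdeal (R ⧸ Ideal.span ((↑) '' t : Set R))
  have h₃ : ringKrullDim R ≤ ringKrullDim (R ⧸ Ideal.span ((↑) '' t : Set R)) + t.ncard := by
    refine (ringKrullDim_le_ringKrullDim_quotient_add_encard ((↑) '' t : Set R) ?_).trans ?_
    · rw [ringJacobson_eq_maximalIdeal]
      exact Ideal.subset_span.trans hI
    · rw [Subtype.val_injective.encard_image, ← hfin.cast_ncard_eq]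
      rfl
  obtain ⟨n, hn⟩ := exists_natCast_eq_ringKrullDim (R ⧸ Ideal.span ((↑) '' t : Set R))
  rw [isRegularLocalRing_iff, hn, ← spanFinrank_maximalIdeal (R := R)]
  rw [← spanFinrank_maximalIdeal, hn] at h₃
  rw [hn] at h₂
  norm_cast at *
  omega

lemma quotient_span_singleton {x : R} (hx : x ∈ maximalIdeal R) (hx' : x ∉ maximalIdeal R ^ 2) :
    IsRegularLocalRing (R ⧸ Ideal.span {x}) ∧
      ringKrullDim (R ⧸ Ideal.span {x}) + 1 = ringKrullDim R := by
  have ht : LinearIndepOn (ResidueField R) (maximalIdeal R).toCotangent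
      {(⟨x, hx⟩ : maximalIdeal R)} :=
    LinearIndepOn.singleton fun h ↦ hx' ((Ideal.toCotangent_eq_zero _ _).mp h)
  have := quotient_of_linearIndepOn ht
  rw [Set.image_singleton, Set.ncard_singleton] at this
  exact_mod_cast this

lemma isField_of_ringKrullDim_eq_zero (h : ringKrullDim R = 0) : IsField R := by
  rw [isField_iff_maximalIdeal_eq, ← Submodule.spanFinrank_eq_zero_iff_eq_bot
    (maximalIdeal R).fg_of_isNoetherianRing]
  exact_mod_cast (spanFinrank_maximalIdeal (R := R)).trans h

lemma exists_mem_maximalIdeal_notMem_sq (h : ringKrullDim R ≠ 0) :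
    ∃ x ∈ maximalIdeal R, x ∉ maximalIdeal R ^ 2 ∧ ∀ p ∈ minimalPrimes R, x ∉ p := by
  classical
  by_contra! hcon
  have hfin := minimalPrimes.finite_of_isNoetherianRing R
  have hsub : ((maximalIdeal R : Ideal R) : Set R) ⊆ ⋃ p ∈
      ((insert (maximalIdeal R ^ 2) hfin.toFinset : Finset (Ideal R)) : Set (Ideal R)), (p : Set R) := by
    intro x hx
    by_cases hx2 : x ∈ maximalIdeal R ^ 2
    · exact Set.mem_biUnion (by simp) hx2
    · obtain ⟨p, hp, hxp⟩ := hcon x hx hx2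
      exact Set.mem_biUnion (by simp [hp]) hxp
  obtain ⟨p, hp, hle : maximalIdeal R ≤ p⟩ := (Ideal.subset_union_prime (f := id) (maximalIdeal R ^ 2)
    (maximalIdeal R ^ 2) (fun p hp hne _ ↦ by
      simp only [Finset.mem_insert, hne, Set.Finite.mem_toFinset, false_or] at hp
      exact (show p.IsPrime from hp.1.1))).mp hsub
  rw [Finset.mem_insert, Set.Finite.mem_toFinset] at hp
  apply h
  rw [← maximalIdeal_height_eq_ringKrullDim]
  norm_cast
  obtain rfl | hp := hp
  · have hbot : maximalIdeal R = ⊥ := Submodule.eq_bot_of_le_smul_of_le_jacobson_bot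
      (maximalIdeal R) (maximalIdeal R) (maximalIdeal R).fg_of_isNoetherianRing
      (by simpa [pow_two] using hle) (maximalIdeal_le_jacobson _)
    rw [hbot, Ideal.height_bot]
  · have hpp : p.IsPrime := hp.1.1
    rw [le_antisymm hle (le_maximalIdeal hpp.ne_top), Ideal.height_eq_zero_iff]
    exact hp

lemma isDomain_of_ringKrullDim_eq (n : ℕ) : ∀ (R : Type*) [CommRing R] [IsRegularLocalRing R],
    ringKrullDim R = n → IsDomain R := by
  induction n with
  | zero => exact fun R _ _ h ↦ (isField_of_ringKrullDim_eq_zero h).isDomain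
  | succ n ih =>
    intro R _ _ h
    obtain ⟨x, hx, hx2, hxp⟩ := exists_mem_maximalIdeal_notMem_sq (R := R) (by
      rw [h]; norm_cast)
    obtain ⟨hreg, hdim⟩ := quotient_span_singleton hx hx2
    have hdom : IsDomain (R ⧸ Ideal.span {x}) := ih _ (by
      obtain ⟨m, hm⟩ := exists_natCast_eq_ringKrullDim (R ⧸ Ideal.span {x})
      rw [h, hm] at hdim
      rw [hm]
      norm_cast at *
      omega)
    have hprime : (Ideal.span {x}).IsPrime := (Ideal.Quotient.isDomain_iff_prime _).mp hdom
    obtain ⟨q, hq, hqx⟩ := Ideal.exists_minimalPrimes_le (J := Ideal.span {x}) bot_le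
    have hqp : q.IsPrime := hq.1.1
    have hbot : q = ⊥ := by
      refine Submodule.eq_bot_of_le_smul_of_le_jacobson_bot (Ideal.span {x}) q
        q.fg_of_isNoetherianRing (fun y hy ↦ ?_)
        (((Ideal.span_singleton_le_iff_mem _).mpr hx).trans (maximalIdeal_le_jacobson _))
      obtain ⟨z, rfl⟩ := Ideal.mem_span_singleton.mp (hqx hy)
      exact Ideal.mul_mem_mul (Ideal.mem_span_singleton_self x)
        ((hqp.mem_or_mem hy).resolve_left (hxp q hq))
    subst hbot
    exact IsDomain.of_bot_isPrime R

theorem isDomain (R : Type*) [CommRing R] [IsRegularLocalRing R] : IsDomain R :=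
  isDomain_of_ringKrullDim_eq _ R spanFinrank_maximalIdeal.symm

lemma isPrime_span_of_linearIndepOn {t : Set (maximalIdeal R)}
    (ht : LinearIndepOn (ResidueField R) (maximalIdeal R).toCotangent t) :
    (Ideal.span ((↑) '' t : Set R)).IsPrime := by
  have := (quotient_of_linearIndepOn ht).1
  exact (Ideal.Quotient.isDomain_iff_prime _).mp (isDomain _)

lemma ncard_le_height_span_of_linearIndepOn {t : Set (maximalIdeal R)}
    (ht : LinearIndepOn (ResidueField R) (maximalIdeal R).toCotangent t) :
    (t.ncard : ℕ∞) ≤ (Ideal.span ((↑) '' t : Set R)).height := by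
  induction t, ht.finite_and_finrank_span_image.1 using Set.Finite.induction_on with
  | empty => simp
  | @insert a s ha hs ih =>
    have hsi := ht.mono (Set.subset_insert a s)
    have hle : Ideal.span ((↑) '' s : Set R) ≤ Ideal.span ((↑) '' (insert a s) : Set R) :=
      Ideal.span_mono (Set.image_mono (Set.subset_insert a s))
    have hlt : Ideal.span ((↑) '' s : Set R) < Ideal.span ((↑) '' (insert a s) : Set R) := by
      refine lt_of_le_of_ne hle fun heq ↦ ?_
      obtain ⟨hreg, h₁⟩ := quotient_of_linearIndepOn hsi
      have h₂ := (quotient_of_linearIndepOn ht).2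
      obtain ⟨n, hn⟩ := exists_natCast_eq_ringKrullDim (R ⧸ Ideal.span ((↑) '' s : Set R))
      rw [← heq, ← h₁, hn, Set.ncard_insert_of_notMem ha hs] at h₂
      norm_cast at h₂
      omega
    have := isPrime_span_of_linearIndepOn hsi
    have := isPrime_span_of_linearIndepOn ht
    rw [Set.ncard_insert_of_notMem ha hs, Nat.cast_add, Nat.cast_one]
    exact (add_le_add_left (ih hsi) 1).trans (Ideal.height_add_one_le_of_lt_of_isPrime hlt)

lemma height_span_of_linearIndepOn {t : Set (maximalIdeal R)}
    (ht : LinearIndepOn (ResidueField R) (maximalIdeal R).toCotangent t) :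
    (Ideal.span ((↑) '' t : Set R)).height = t.ncard := by
  refine le_antisymm ?_ (ncard_le_height_span_of_linearIndepOn ht)
  rw [ht.finite_and_finrank_span_image.1.cast_ncard_eq, ← Subtype.val_injective.encard_image]
  exact (Ideal.height_le_spanFinrank _ (isPrime_span_of_linearIndepOn ht).ne_top).trans
    (Submodule.spanFinrank_span_le_encard _)

end IsRegularLocalRing

namespace IsLocalRing

variable {R : Type*} [CommRing R] [IsLocalRing R]

/-- The image of `J / 𝔪J` in the cotangent space `𝔪 / 𝔪²`. -/
noncomputable def cotangentImage (J : Ideal R) : Submodule (ResidueField R) (CotangentSpace R) :=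
  Submodule.span (ResidueField R)
    ((maximalIdeal R).toCotangent '' {x : maximalIdeal R | (x : R) ∈ J})

variable [IsNoetherianRing R]

lemma exists_linearIndepOn_ncard_eq_finrank_cotangentImage (J : Ideal R) :
    ∃ t : Set (maximalIdeal R), Ideal.span ((↑) '' t : Set R) ≤ J ∧
      LinearIndepOn (ResidueField R) (maximalIdeal R).toCotangent t ∧
      t.ncard = Module.finrank (ResidueField R) (cotangentImage J) := by
  obtain ⟨t, htJ, -, hspan, ht⟩ := exists_linearIndepOn_extension
    (linearIndepOn_empty (ResidueField R) (maximalIdeal R).toCotangent)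
    (Set.empty_subset {x : maximalIdeal R | (x : R) ∈ J})
  refine ⟨t, ?_, ht, ?_⟩
  · rw [Ideal.span_le]
    rintro _ ⟨x, hx, rfl⟩
    exact htJ hx
  · rw [← ht.finite_and_finrank_span_image.2, cotangentImage]
    rw [le_antisymm (Submodule.span_mono (Set.image_mono htJ)) (Submodule.span_le.mpr hspan)]

lemma spanFinrank_le_spanFinrank_quotient_add_finrank_cotangentImage {J : Ideal R}
    (hJ : J ≤ maximalIdeal R) [IsLocalRing (R ⧸ J)] :
    (maximalIdeal R).spanFinrank ≤ (maximalIdeal (R ⧸ J)).spanFinrank +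
      Module.finrank (ResidueField R) (cotangentImage J) := by
  obtain ⟨w, hcard, hw⟩ :=
    Submodule.FG.exists_span_finset_card_eq_spanFinrank
      (maximalIdeal (R ⧸ J)).fg_of_isNoetherianRing
  let f := Ideal.Quotient.mk J
  have hmap : (maximalIdeal R).map f = maximalIdeal (R ⧸ J) :=
    map_maximalIdeal_of_surjective f Ideal.Quotient.mk_surjective
  have hsub : (w : Set (R ⧸ J)) ⊆ Set.range fun x : maximalIdeal R ↦ f x := by
    intro y hy
    have : y ∈ (maximalIdeal R).map f := hmap ▸ hw ▸ Submodule.subset_span hy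
    obtain ⟨x, hx, rfl⟩ := (Ideal.mem_map_iff_of_surjective f Ideal.Quotient.mk_surjective).mp this
    exact ⟨⟨x, hx⟩, rfl⟩
  obtain ⟨L, -, hL⟩ := Set.exists_subset_bijOn
    ((fun x : maximalIdeal R ↦ f x) ⁻¹' (w : Set (R ⧸ J))) (fun x : maximalIdeal R ↦ f x)
  rw [Set.image_preimage_eq_of_subset hsub] at hL
  have hLfin : L.Finite := hL.finite_iff_finite.mpr w.finite_toSet
  have hLcard : L.ncard = w.card := by
    rw [← Set.ncard_coe_finset, ← hL.image_eq, hL.injOn.ncard_image]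
  have hJspan : Ideal.span ((↑) '' {x : maximalIdeal R | (x : R) ∈ J} : Set R) = J := by
    convert Ideal.span_eq J
    ext x
    simpa using fun hx ↦ hJ hx
  have hmapL : (Ideal.span ((↑) '' L : Set R)).map f = maximalIdeal (R ⧸ J) := by
    rw [Ideal.map_span, Set.image_image, hL.image_eq]
    exact hw
  have htop : Ideal.span ((↑) '' ({x : maximalIdeal R | (x : R) ∈ J} ∪ L) : Set R) =
      maximalIdeal R := by
    rw [Set.image_union, Ideal.span_union, hJspan,
      ← Ideal.comap_map_mk (I := J) (J := J ⊔ _) le_sup_left, Ideal.map_sup, Ideal.map_quotient_self,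
      bot_sup_eq, hmapL, ← hmap, Ideal.comap_map_mk hJ]
  rw [span_coe_eq_maximalIdeal_iff, ← CotangentSpace.span_image_eq_top_iff, Set.image_union,
    Submodule.span_union] at htop
  have hle := Submodule.finrank_add_le_finrank_add_finrank (cotangentImage J)
    (Submodule.span (ResidueField R) ((maximalIdeal R).toCotangent '' L))
  rw [cotangentImage, htop, finrank_top, ← spanFinrank_maximalIdeal_eq_finrank_cotangentSpace,
    ← cotangentImage] at hle
  have hL' : Module.finrank (ResidueField R) (Submodule.span (ResidueField R)
      ((maximalIdeal R).toCotangent '' L)) ≤ L.ncard := by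
    have := (hLfin.image (maximalIdeal R).toCotangent).fintype
    refine (finrank_span_le_card _).trans ?_
    rw [← Set.ncard_eq_toFinset_card']
    exact Set.ncard_image_le hLfin
  rw [← hcard, ← hLcard, add_comm]
  exact hle.trans (Nat.add_le_add_left hL' _)

end IsLocalRing

namespace IsRegularLocalRing

variable {R : Type*} [CommRing R] [IsRegularLocalRing R]

/-- A quotient `R ⧸ J` of a regular local ring is regular if and only if the image of `J` in the
cotangent space has dimension equal to the height of `J`. -/
theorem quotient_iff_finrank_cotangentImage_eq_height {J : Ideal R} (hJ : J ≤ maximalIdeal R) :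
    IsRegularLocalRing (R ⧸ J) ↔
      (Module.finrank (ResidueField R) (cotangentImage J) : ℕ∞) = J.height := by
  obtain ⟨t, htJ, ht, hcard⟩ := exists_linearIndepOn_ncard_eq_finrank_cotangentImage J
  have hprime := isPrime_span_of_linearIndepOn ht
  obtain ⟨hreg, hdim⟩ := quotient_of_linearIndepOn ht
  rw [← hcard, ← height_span_of_linearIndepOn ht]
  refine ⟨fun hRJ ↦ ?_, fun h ↦ ?_⟩
  · have hle := spanFinrank_le_spanFinrank_quotient_add_finrank_cotangentImage hJ
    rw [← hcard, ← Nat.cast_le (α := WithBot ℕ∞), Nat.cast_add, spanFinrank_maximalIdeal,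
      spanFinrank_maximalIdeal, ← hdim] at hle
    congr 1
    refine Ideal.eq_of_le_of_ringKrullDim_quotient_le htJ ?_
    obtain ⟨m, hm⟩ := exists_natCast_eq_ringKrullDim (R ⧸ Ideal.span ((↑) '' t : Set R))
    obtain ⟨n, hn⟩ := exists_natCast_eq_ringKrullDim (R ⧸ J)
    rw [hm, hn] at hle ⊢
    norm_cast at *
    omega
  · rw [height_span_of_linearIndepOn ht] at h
    obtain ⟨Q, hQ, hJQ, hQh⟩ := Ideal.exists_isPrime_height_eq h.symm
    have hPQ := Ideal.eq_of_le_of_height_le _ (htJ.trans hJQ)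
      (hQh.trans (height_span_of_linearIndepOn ht).symm).le
    rwa [le_antisymm (hPQ ▸ hJQ) htJ]

end IsRegularLocalRing

lemma idealHeight_eq_height {A : Type*} [CommRing A] (J : Ideal A) : idealHeight J = J.height := by
  refine le_antisymm ?_ (le_iInf₂ fun P hP ↦ ?_)
  · rw [Ideal.height_eq_inf_minimalPrimes]
    refine le_iInf₂ fun P hP ↦ (iInf₂_le (⟨P, hP.1.1⟩ : PrimeSpectrum A) hP.1.2).trans ?_
    rw [← PrimeSpectrum.height_eq_orderHeight]
  · rw [← PrimeSpectrum.height_eq_orderHeight]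
    exact Ideal.height_mono hP

lemma isRegularLocal_iff_isRegularLocalRing (A : Type*) [CommRing A] :
    IsRegularLocal A ↔ IsRegularLocalRing A := by
  have key (_ : IsLocalRing A) : sInf {n : ℕ | ∃ s : Finset A, s.card = n ∧
      Ideal.span (s : Set A) = maximalIdeal A} = (maximalIdeal A).spanFinrank := by
    rw [Submodule.spanFinrank_eq_iInf, iInf]
    congr 1
    ext n
    simp [Ideal.span, and_comm]
  refine ⟨fun ⟨_, _, h⟩ ↦ ?_, fun h ↦ ⟨inferInstance, inferInstance, ?_⟩⟩
  · rw [isRegularLocalRing_iff, h, key]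
  · rw [key, h.spanFinrank_maximalIdeal]

/-- Let `(A, 𝔪, k)` be a regular local ring and `J ⊆ 𝔪` an ideal of height
`h`.  Then `A/J` is a regular local ring if and only if the rank of the induced `k`-linear map
`J/𝔪J → 𝔪/𝔪²` (i.e. the dimension of the image of `J` in the cotangent space `𝔪/𝔪²`)
equals `h`. -/
theorem statement5 {A : Type*} [CommRing A] [IsLocalRing A]
    (hA : IsRegularLocal A)
    (J : Ideal A) (hJ : J ≤ maximalIdeal A)
    (h : ℕ) (hh : idealHeight J = (h : ℕ∞)) :
    IsRegularLocal (A ⧸ J) ↔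
      Module.finrank (ResidueField A)
        (Submodule.span (ResidueField A)
          ((maximalIdeal A).toCotangent '' {x : maximalIdeal A | (x : A) ∈ J})) = h := by
  have hreg := (isRegularLocal_iff_isRegularLocalRing A).mp hA
  rw [idealHeight_eq_height] at hh
  rw [isRegularLocal_iff_isRegularLocalRing,
    IsRegularLocalRing.quotient_iff_finrank_cotangentImage_eq_height hJ, hh, Nat.cast_inj,
    cotangentImage]
end
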